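/- arXiv:2006.14481 — 3 statements merged into one kernel-verified Lean document; each statement's English description precedes it below -/
import Mathlib

section
/- Let C > 0 be a real number, let r, n, d be positive integers with r ≤ d, and let a_1, …, a_n ∈ ℝ^d be vectors with ‖a_i‖₂ ≤ 1 for all i that all lie in a linear subspace of ℝ^d of dimension r. Then ln det(I + C² Σ_{i=1}^n a_i a_iᵀ) ≤ r · ln(1 + C² n / r). -/
open Matrix BigOperators

lemma det_one_add_aux {d : ℕ} (M : Matrix (Fin d) (Fin d) ℝ) (hM : M.IsHermitian) :
    (1 + M).det = ∏ i, (1 + hM.eigenvalues i) := by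
  have h := congrArg (Polynomial.eval (-1)) hM.charpoly_eq
  rw [Matrix.eval_charpoly, Polynomial.eval_prod] at h
  have e1 : (Matrix.scalar (Fin d)) (-1 : ℝ) - M = -(1 + M) := by
    rw [map_neg, map_one]; abel
  have e2 : ∀ i, Polynomial.eval (-1) (Polynomial.X - Polynomial.C ((hM.eigenvalues i : ℝ)))
      = -(1 + hM.eigenvalues i) := by
    intro i; simp; ring
  rw [e1, Matrix.det_neg] at h
  simp only [RCLike.ofReal_real_eq_id, id, e2, Finset.prod_neg] at h
  simp only [Finset.card_univ] at h
  exact mul_left_cancel₀ (pow_ne_zero _ (by norm_num)) h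

lemma log_term_aux (s l : ℝ) (hs : 0 ≤ s) (hl : 0 ≤ l) :
    Real.log (1 + l) ≤ (if l ≠ 0 then (Real.log (1 + s) - s / (1 + s)) else 0) + l / (1 + s) := by
  by_cases h : l = 0
  · simp [h]
  · rw [if_pos h]
    have h1 : Real.log ((1 + l) / (1 + s)) ≤ (1 + l) / (1 + s) - 1 :=
      Real.log_le_sub_one_of_pos (by positivity)
    rw [Real.log_div (by positivity) (by positivity)] at h1
    have h2 : (1 + l) / (1 + s) - 1 = l / (1 + s) - s / (1 + s) := by
      field_simp; ring
    linarith

/-- determinant bound for vectors of norm at most 1 lying in an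
`r`-dimensional subspace. -/
theorem stmt_1 (C : ℝ) (hC : 0 < C) (r n d : ℕ) (hr : 0 < r) (hn : 0 < n) (hd : 0 < d)
    (hrd : r ≤ d) (a : Fin n → (Fin d → ℝ))
    (hnorm : ∀ i, ∑ j, (a i j) ^ 2 ≤ 1)
    (V : Submodule ℝ (Fin d → ℝ)) (hV : Module.finrank ℝ V = r)
    (haV : ∀ i, a i ∈ V) :
    Real.log ((1 : Matrix (Fin d) (Fin d) ℝ) +
        C ^ 2 • ∑ i, vecMulVec (a i) (a i)).det ≤
      r * Real.log (1 + C ^ 2 * n / r) := by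
  set M : Matrix (Fin d) (Fin d) ℝ := C ^ 2 • ∑ i, vecMulVec (a i) (a i) with hMdef
  have hP : M.PosSemidef := by
    refine Matrix.PosSemidef.smul (Matrix.posSemidef_sum _ fun i _ => ?_) (by positivity)
    simpa using Matrix.posSemidef_vecMulVec_self_star (a i)
  have hM := hP.isHermitian
  have hrank : M.rank ≤ r := by
    rw [← hV, Matrix.rank]
    apply Submodule.finrank_mono
    rintro _ ⟨v, rfl⟩
    rw [Matrix.mulVecLin_apply, hMdef, Matrix.smul_mulVec, Matrix.sum_mulVec]
    refine V.smul_mem _ (V.sum_mem fun i _ => ?_)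
    rw [Matrix.vecMulVec_mulVec]
    simpa using V.smul_mem _ (haV i)
  have htr : ∑ i, hM.eigenvalues i ≤ C ^ 2 * n := by
    have h := hM.trace_eq_sum_eigenvalues
    simp only [RCLike.ofReal_real_eq_id, id] at h
    rw [← h, hMdef, Matrix.trace_smul, Matrix.trace_sum, smul_eq_mul]
    gcongr
    calc ∑ i, (vecMulVec (a i) (a i)).trace ≤ ∑ i : Fin n, (1 : ℝ) := by
          refine Finset.sum_le_sum fun i _ => ?_
          rw [Matrix.trace_vecMulVec]
          simpa [dotProduct, sq] using hnorm i
      _ = n := by simp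
  have hr' : (0 : ℝ) < r := by exact_mod_cast hr
  set s : ℝ := C ^ 2 * n / r with hs
  have hs0 : 0 ≤ s := by positivity
  have hnn := hP.eigenvalues_nonneg
  rw [det_one_add_aux M hM, Real.log_prod (fun i _ => by have := hnn i; positivity)]
  have hg : 0 ≤ Real.log (1 + s) - s / (1 + s) := by
    have := Real.one_sub_inv_le_log_of_pos (x := 1 + s) (by positivity)
    have h2 : s / (1 + s) = 1 - (1 + s)⁻¹ := by field_simp; ring
    linarith
  have hk : (((Finset.univ.filter fun i => hM.eigenvalues i ≠ 0).card : ℕ) : ℝ) ≤ r := by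
    have := hM.rank_eq_card_non_zero_eigs
    rw [Fintype.card_subtype] at this
    rw [this] at hrank
    exact_mod_cast hrank
  calc ∑ i, Real.log (1 + hM.eigenvalues i)
      ≤ ∑ i, ((if hM.eigenvalues i ≠ 0 then (Real.log (1 + s) - s / (1 + s)) else 0)
          + hM.eigenvalues i / (1 + s)) :=
        Finset.sum_le_sum fun i _ => log_term_aux s _ hs0 (hnn i)
    _ = ((Finset.univ.filter fun i => hM.eigenvalues i ≠ 0).card : ℝ)
          * (Real.log (1 + s) - s / (1 + s)) + (∑ i, hM.eigenvalues i) / (1 + s) := by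
        rw [Finset.sum_add_distrib, ← Finset.sum_filter, Finset.sum_const, nsmul_eq_mul,
          Finset.sum_div]
    _ ≤ r * (Real.log (1 + s) - s / (1 + s)) + (r * s) / (1 + s) := by
        have : (r : ℝ) * s = C ^ 2 * n := by rw [hs]; field_simp
        rw [this]
        gcongr
    _ = r * Real.log (1 + s) := by ring
end

section
/- Let d be a positive integer, λ > 0 a real number, and let M = λI + P be a real symmetric d×d matrix where P is symmetric positive semidefinite. Then for all x, θ ∈ ℝ^d, |λ · xᵀ M^{−1} θ| ≤ √λ · ‖θ‖₂ · √(xᵀ M^{−1} x). -/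
open Matrix BigOperators

/-- Cauchy–Schwarz bound on the regularization-bias term. -/
theorem stmt_4 (d : ℕ) (hd : 0 < d) (lam : ℝ) (hlam : 0 < lam)
    (P M : Matrix (Fin d) (Fin d) ℝ) (hP : P.PosSemidef)
    (hM : M = lam • (1 : Matrix (Fin d) (Fin d) ℝ) + P) :
    ∀ x θ : Fin d → ℝ,
      |lam * (x ⬝ᵥ M⁻¹ *ᵥ θ)| ≤
        Real.sqrt lam * Real.sqrt (∑ j, (θ j) ^ 2) * Real.sqrt (x ⬝ᵥ M⁻¹ *ᵥ x) := by
  intro x θ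
  have hMpd : M.PosDef := by
    rw [hM]
    exact (Matrix.PosDef.one.smul hlam).add_posSemidef hP
  have hsym : Mᵀ = M := by
    have h := hMpd.isHermitian.eq
    rwa [conjTranspose_eq_transpose_of_trivial] at h
  have hdet : IsUnit M.det := hMpd.det_pos.ne'.isUnit
  obtain ⟨y, hy⟩ : ∃ y, y = M⁻¹ *ᵥ x := ⟨_, rfl⟩
  have hx : M *ᵥ y = x := by
    rw [hy, mulVec_mulVec, mul_nonsing_inv M hdet, one_mulVec]
  have h1 : ∀ v, x ⬝ᵥ M⁻¹ *ᵥ v = y ⬝ᵥ v := by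
    intro v
    rw [dotProduct_mulVec, ← mulVec_transpose, transpose_nonsing_inv, hsym, hy]
  have h2 : lam * ∑ j, y j ^ 2 ≤ y ⬝ᵥ x := by
    have h3 : 0 ≤ y ⬝ᵥ P *ᵥ y := by simpa using hP.dotProduct_mulVec_nonneg y
    have h4 : y ⬝ᵥ y = ∑ j, y j ^ 2 := by simp [dotProduct, sq]
    rw [← hx, hM, add_mulVec, smul_mulVec, one_mulVec, dotProduct_add, dotProduct_smul,
      h4, smul_eq_mul]
    linarith
  have hcs : (y ⬝ᵥ θ) ^ 2 ≤ (∑ j, y j ^ 2) * ∑ j, θ j ^ 2 :=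
    Finset.sum_mul_sq_le_sq_mul_sq _ _ _
  have hθ : 0 ≤ ∑ j, θ j ^ 2 := Finset.sum_nonneg fun j _ => sq_nonneg _
  rw [h1, h1, ← Real.sqrt_mul hlam.le, ← Real.sqrt_mul (mul_nonneg hlam.le hθ)]
  apply Real.abs_le_sqrt
  calc (lam * (y ⬝ᵥ θ)) ^ 2 = lam ^ 2 * (y ⬝ᵥ θ) ^ 2 := by ring
    _ ≤ lam ^ 2 * ((∑ j, y j ^ 2) * ∑ j, θ j ^ 2) := by gcongr
    _ = lam * (∑ j, θ j ^ 2) * (lam * ∑ j, y j ^ 2) := by ring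
    _ ≤ lam * (∑ j, θ j ^ 2) * (y ⬝ᵥ x) := by gcongr
end

section
/- Let m be a positive integer, let d_u > 0 and T_u > 0 be real numbers for u ∈ {1,…,m}, and let B > 0. Suppose μ* ∈ (0,1]^m minimizes Σ_{u=1}^m d_u/μ_u over all μ ∈ (0,1]^m satisfying Σ_{u=1}^m μ_u T_u ≤ B. Then there exists a constant C > 0 such that μ*_u = min(1, C·√(d_u/T_u)) for every u ∈ {1,…,m}. -/
open BigOperators

lemma exch (m : ℕ) (d T : Fin m → ℝ)
    (hd : ∀ u, 0 < d u) (hT : ∀ u, 0 < T u) (B : ℝ)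
    (μs : Fin m → ℝ) (hμs0 : ∀ u, 0 < μs u) (hμs1 : ∀ u, μs u ≤ 1)
    (hμsbudget : ∑ u, μs u * T u ≤ B)
    (hmin : ∀ μ : Fin m → ℝ, (∀ u, 0 < μ u) → (∀ u, μ u ≤ 1) →
      ∑ u, μ u * T u ≤ B → ∑ u, d u / μs u ≤ ∑ u, d u / μ u)
    (u v : Fin m) (hne : u ≠ v) (hu : μs u < 1) :
    (d u / T u) * μs v ^ 2 ≤ (d v / T v) * μs u ^ 2 := by
  by_contra! hlt
  have c1 : ∀ᶠ ε in nhds (0:ℝ), (d v / T v) * (μs u * (μs u + ε / T u)) <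
      (d u / T u) * (μs v * (μs v - ε / T v)) := by
    apply ContinuousAt.eventually_lt
    · fun_prop
    · fun_prop
    · simpa [sq] using hlt
  have c2 : ∀ᶠ ε in nhds (0:ℝ), μs u + ε / T u < 1 := by
    apply ContinuousAt.eventually_lt
    · fun_prop
    · fun_prop
    · simpa using hu
  have c3 : ∀ᶠ ε in nhds (0:ℝ), 0 < μs v - ε / T v := by
    apply ContinuousAt.eventually_lt
    · fun_prop
    · fun_prop
    · simpa using hμs0 v
  have c := (((c1.and (c2.and c3)).filter_mono nhdsWithin_le_nhds).and
    (self_mem_nhdsWithin (s := Set.Ioi (0:ℝ)))).exists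
  obtain ⟨ε, ⟨h1, h2, h3⟩, hε⟩ := c
  have hε : 0 < ε := hε
  have tu := hT u
  have tv := hT v
  have mu := hμs0 u
  have mv := hμs0 v
  have eu : 0 < ε / T u := by positivity
  have ev : 0 < ε / T v := by positivity
  let μ : Fin m → ℝ := fun w => if w = u then μs u + ε / T u else
    if w = v then μs v - ε / T v else μs w
  have au : μ u = μs u + ε / T u := by simp [μ]
  have av : μ v = μs v - ε / T v := by simp [μ, hne.symm]
  have aw : ∀ w, w ≠ u → w ≠ v → μ w = μs w := by
    intro w h h'; simp [μ, h, h']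
  have key := hmin μ ?_ ?_ ?_
  · have : ∑ w, (d w / μ w - d w / μs w) =
        (d u / μ u - d u / μs u) + (d v / μ v - d v / μs v) := by
      apply Finset.sum_eq_add u v hne
      · intro w _ hw; rw [aw w hw.1 hw.2]; ring
      · simp
      · simp
    rw [Finset.sum_sub_distrib, au, av] at this
    have p : 0 < μs u + ε / T u := by positivity
    have e1 : d u / (μs u + ε / T u) - d u / μs u =
        - (ε * ((d u / T u) / (μs u * (μs u + ε / T u)))) := by
      rw [div_sub_div _ _ p.ne' mu.ne', mul_div_assoc', ← neg_div,
        div_eq_div_iff (by positivity) (by positivity)]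
      ring
    have e2 : d v / (μs v - ε / T v) - d v / μs v =
        ε * ((d v / T v) / (μs v * (μs v - ε / T v))) := by
      rw [div_sub_div _ _ h3.ne' mv.ne', mul_div_assoc',
        div_eq_div_iff (by positivity) (by positivity)]
      ring
    have e3 : (d v / T v) / (μs v * (μs v - ε / T v)) <
        (d u / T u) / (μs u * (μs u + ε / T u)) := by
      rw [div_lt_div_iff₀ (by positivity) (by positivity)]
      exact h1
    have := mul_lt_mul_of_pos_left e3 hε
    linarith
  · intro w
    by_cases h : w = u
    · subst h; rw [au]; positivity
    by_cases h' : w = v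
    · subst h'; rw [av]; exact h3
    rw [aw w h h']; exact hμs0 w
  · intro w
    by_cases h : w = u
    · subst h; rw [au]; exact h2.le
    by_cases h' : w = v
    · subst h'; rw [av]; linarith [hμs1 w]
    rw [aw w h h']; exact hμs1 w
  · have : ∑ w, (μ w * T w - μs w * T w) =
        (μ u * T u - μs u * T u) + (μ v * T v - μs v * T v) := by
      apply Finset.sum_eq_add u v hne
      · intro w _ hw; rw [aw w hw.1 hw.2]; ring
      · simp
      · simp
    rw [Finset.sum_sub_distrib, au, av] at this
    have q1 : (μs u + ε / T u) * T u = μs u * T u + ε := by field_simp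
    have q2 : (μs v - ε / T v) * T v = μs v * T v - ε := by field_simp
    linarith

/-- Theorem 9 of the paper: structure of the optimal solution of the
program `min Σ_u d_u/μ_u` subject to `Σ_u μ_u T_u ≤ B` and `μ_u ∈ (0,1]`. -/
theorem stmt_12 (m : ℕ) (hm : 0 < m) (d T : Fin m → ℝ)
    (hd : ∀ u, 0 < d u) (hT : ∀ u, 0 < T u) (B : ℝ) (hB : 0 < B)
    (μs : Fin m → ℝ) (hμs0 : ∀ u, 0 < μs u) (hμs1 : ∀ u, μs u ≤ 1)
    (hμsbudget : ∑ u, μs u * T u ≤ B)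
    (hmin : ∀ μ : Fin m → ℝ, (∀ u, 0 < μ u) → (∀ u, μ u ≤ 1) →
      ∑ u, μ u * T u ≤ B → ∑ u, d u / μs u ≤ ∑ u, d u / μ u) :
    ∃ C : ℝ, 0 < C ∧ ∀ u, μs u = min 1 (C * Real.sqrt (d u / T u)) := by
  have hs : ∀ u, 0 < Real.sqrt (d u / T u) := fun u =>
    Real.sqrt_pos.2 (div_pos (hd u) (hT u))
  haveI : Nonempty (Fin m) := ⟨⟨0, hm⟩⟩
  obtain ⟨v, hv⟩ := Finite.exists_max (fun u => μs u / Real.sqrt (d u / T u))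
  refine ⟨μs v / Real.sqrt (d v / T v), div_pos (hμs0 v) (hs v), fun u => ?_⟩
  have h1 : μs u ≤ μs v / Real.sqrt (d v / T v) * Real.sqrt (d u / T u) :=
    (div_le_iff₀ (hs u)).1 (hv u)
  rcases (hμs1 u).lt_or_eq with hu | hu
  · have h2 : μs v / Real.sqrt (d v / T v) * Real.sqrt (d u / T u) ≤ μs u := by
      by_cases hne : u = v
      · subst hne; rw [div_mul_cancel₀ _ (hs u).ne']
      have := exch m d T hd hT B μs hμs0 hμs1 hμsbudget hmin u v hne hu
      rw [div_mul_eq_mul_div, div_le_iff₀ (hs v)]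
      refine (sq_le_sq₀ (mul_pos (hμs0 v) (hs u)).le (mul_pos (hμs0 u) (hs v)).le).1 ?_
      rw [mul_pow, mul_pow, Real.sq_sqrt (div_pos (hd u) (hT u)).le,
        Real.sq_sqrt (div_pos (hd v) (hT v)).le]
      linarith
    have h3 := le_antisymm h1 h2
    rw [← h3, min_eq_right hu.le]
  · rw [min_eq_left (by linarith), hu]
end
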